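/- For all integers k > t ≥ 6, the optimal redundancy of function-correcting symbol-pair codes for the pair weight function satisfies r_p^{wt_p}(k,t) ≥ 8t/3 − (8/9)·√(6t−4) − 4/3 (an inequality of real numbers). -/

import Mathlib

/-- The symbol-pair distance between two binary vectors of length `n`:
the number of indices `i` at which the cyclically consecutive pairs
`(x i, x (i+1 mod n))` and `(y i, y (i+1 mod n))` differ. -/
def pairDist {n : ℕ} (x y : Fin n → ZMod 2) : ℕ :=
  (Finset.univ.filter fun i : Fin n =>
    (x i, x ⟨((i : ℕ) + 1) % n, Nat.mod_lt _ (Nat.zero_lt_of_lt i.isLt)⟩) ≠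
      (y i, y ⟨((i : ℕ) + 1) % n, Nat.mod_lt _ (Nat.zero_lt_of_lt i.isLt)⟩)).card

/-- The pair weight `wt_p(u) = d_p(u, 0)`. -/
def pairWt {n : ℕ} (u : Fin n → ZMod 2) : ℕ := pairDist u 0

/-- The optimal redundancy `r_p^{wt_p}(k,t)` of function-correcting symbol-pair
codes for the pair weight function. -/
noncomputable def optPairRedundancy (k t : ℕ) : ℕ :=
  sInf {r : ℕ | ∃ p : (Fin k → ZMod 2) → (Fin r → ZMod 2),
    ∀ u v : Fin k → ZMod 2, pairWt u ≠ pairWt v →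
      2 * t + 1 ≤ pairDist (Fin.append u (p u)) (Fin.append v (p v))}

open Finset in
theorem aux_plotkin (M : ℕ) (a : Fin M → ZMod 2 × ZMod 2) :
    4 * ∑ i, ∑ j, (if a i ≠ a j then 1 else 0 : ℕ) ≤ 3 * M ^ 2 := by
  classical
  set n : ZMod 2 × ZMod 2 → ℕ := fun b => ∑ i, (if a i = b then 1 else 0) with hn
  have h1 : ∑ b, n b = M := by
    rw [hn, Finset.sum_comm]; simp
  have h2 : ∑ b, n b ^ 2 = ∑ i, ∑ j, (if a i = a j then 1 else 0 : ℕ) := by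
    have : ∀ b, n b ^ 2 = ∑ i, ∑ j, (if a i = b then 1 else 0) * (if a j = b then 1 else 0) := by
      intro b
      rw [sq, hn, Finset.sum_mul_sum]
    simp only [this]
    rw [Finset.sum_comm]
    refine Finset.sum_congr rfl fun i _ => ?_
    rw [Finset.sum_comm]
    refine Finset.sum_congr rfl fun j _ => ?_
    simp [eq_comm]
  have h3 : (∑ b, n b) ^ 2 ≤ 4 * ∑ b, n b ^ 2 := by
    have := sq_sum_le_card_mul_sum_sq (s := (Finset.univ : Finset (ZMod 2 × ZMod 2))) (f := n)
    have hc : (Finset.univ : Finset (ZMod 2 × ZMod 2)).card = 4 := by decide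
    rw [hc] at this
    exact_mod_cast this
  have h4 : ∑ i, ∑ j, (if a i ≠ a j then 1 else 0 : ℕ) +
      ∑ i, ∑ j, (if a i = a j then 1 else 0 : ℕ) = M ^ 2 := by
    rw [← Finset.sum_add_distrib]
    simp only [← Finset.sum_add_distrib]
    have : ∀ i j, ((if a i ≠ a j then 1 else 0) + (if a i = a j then 1 else 0) : ℕ) = 1 := by
      intro i j; by_cases h : a i = a j <;> simp [h]
    simp only [this]; simp [sq]
  rw [h1, h2] at h3
  omega

theorem aux_sum1 (M : ℕ) : 2 * ∑ i ∈ Finset.range M, (M - i) = M ^ 2 + M := by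
  induction M with
  | zero => simp
  | succ n ih =>
    rw [Finset.sum_range_succ']
    have : ∀ i ∈ Finset.range n, (n + 1 - (i + 1)) = n - i := by intro i _; omega
    rw [Finset.sum_congr rfl this, mul_add, ih]; simp; ring

theorem aux_sum (M : ℕ) :
    3 * ∑ i ∈ Finset.range M, ∑ j ∈ Finset.range M, ((i - j) + (j - i)) + M = M ^ 3 := by
  induction M with
  | zero => simp
  | succ n ih =>
    rw [Finset.sum_range_succ]
    have h1 : ∀ i ∈ Finset.range n, ∑ j ∈ Finset.range (n + 1), ((i - j) + (j - i)) =
        ∑ j ∈ Finset.range n, ((i - j) + (j - i)) + (n - i) := by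
      intro i hi
      rw [Finset.sum_range_succ]
      have := Finset.mem_range.1 hi
      omega
    have h2 : ∑ j ∈ Finset.range (n + 1), ((n - j) + (j - n)) = ∑ j ∈ Finset.range n, (n - j) := by
      rw [Finset.sum_range_succ]
      simp only [Nat.sub_self, add_zero]
      refine Finset.sum_congr rfl fun j hj => ?_
      have := Finset.mem_range.1 hj
      omega
    rw [Finset.sum_congr rfl h1, h2, Finset.sum_add_distrib]
    have := aux_sum1 n
    nlinarith

/-- The vector `1^i 0^(k-i)`. -/
def stepVec (k i : ℕ) : Fin k → ZMod 2 := fun c => if (c : ℕ) < i then 1 else 0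

theorem stepVec_wt_lt (k i j : ℕ) (hij : i < j) (hj : j < k) :
    pairWt (stepVec k i) < pairWt (stepVec k j) := by
  unfold pairWt pairDist
  apply Finset.card_lt_card
  rw [Finset.ssubset_iff_of_subset]
  · refine ⟨⟨j - 1, by omega⟩, ?_, ?_⟩
    · have : j - 1 < j := by omega
      simp [stepVec, this]
    · have h1 : ¬ (j - 1 < i) := by omega
      have h2 : j - 1 + 1 = j := by omega
      have h3 : ¬ (j < i) := by omega
      simp [stepVec, h1, h2, Nat.mod_eq_of_lt hj, h3]
  · intro c
    simp only [Finset.mem_filter, Finset.mem_univ, true_and, stepVec, ne_eq, Prod.mk.injEq,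
      Pi.zero_apply, ite_eq_right_iff, one_ne_zero, imp_false, not_and_or, not_not]
    omega

/-- Cyclic pair of `x` at `c`. -/
def pairAt {n : ℕ} (x : Fin n → ZMod 2) (i : Fin n) : ZMod 2 × ZMod 2 :=
  (x i, x ⟨((i : ℕ) + 1) % n, Nat.mod_lt _ (Nat.zero_lt_of_lt i.isLt)⟩)

theorem pairDist_eq {n : ℕ} (x y : Fin n → ZMod 2) :
    pairDist x y = ∑ c, (if pairAt x c ≠ pairAt y c then 1 else 0) := by
  unfold pairDist pairAt
  rw [Finset.card_filter]

theorem head_bound (k r i j : ℕ) (p q : Fin r → ZMod 2) :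
    ∑ c ∈ Finset.univ.filter (fun c : Fin (k + r) => (c : ℕ) + 1 < k),
      (if pairAt (Fin.append (stepVec k i) p) c ≠ pairAt (Fin.append (stepVec k j) q) c
        then 1 else 0) ≤ (i - j) + (j - i) + 1 := by
  rw [← Finset.card_filter]
  have hap : ∀ (i : ℕ) (p : Fin r → ZMod 2) (c : ℕ) (h : c < k + r), c < k →
      Fin.append (stepVec k i) p ⟨c, h⟩ = if c < i then 1 else 0 := by
    intro i p c h hc
    have : (⟨c, h⟩ : Fin (k + r)) = Fin.castAdd r ⟨c, hc⟩ := rfl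
    rw [this, Fin.append_left]; rfl
  have hsub : ∀ c ∈ (Finset.univ.filter (fun c : Fin (k + r) => (c : ℕ) + 1 < k)).filter
      (fun c => pairAt (Fin.append (stepVec k i) p) c ≠ pairAt (Fin.append (stepVec k j) q) c),
      (c : ℕ) + 1 ∈ Finset.Icc (min i j) (max i j) := by
    intro c hc
    simp only [Finset.mem_filter, Finset.mem_univ, true_and] at hc
    obtain ⟨hck, hne⟩ := hc
    obtain ⟨c, hcn⟩ := c
    simp only at hck
    have hm : (c + 1) % (k + r) = c + 1 := Nat.mod_eq_of_lt (by omega)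
    rw [Finset.mem_Icc]
    by_contra hcon
    apply hne
    unfold pairAt
    simp only [hm]
    rw [hap i p c hcn (by omega), hap j q c hcn (by omega), hap i p _ _ hck, hap j q _ _ hck]
    have e1 : c < i ↔ c < j := by simp only at hcon; omega
    have e2 : c + 1 < i ↔ c + 1 < j := by simp only at hcon; omega
    simp only [e1, e2]
  have hle := Finset.card_le_card_of_injOn (fun c : Fin (k + r) => (c : ℕ) + 1) hsub (by
    intro a _ b _ hab
    simp only at hab
    exact Fin.ext (by omega))
  rw [Nat.card_Icc] at hle
  omega

theorem main_nat (k t r M : ℕ) (hM : M ≤ k) (hk : 0 < k)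
    (p : (Fin k → ZMod 2) → (Fin r → ZMod 2))
    (hp : ∀ u v : Fin k → ZMod 2, pairWt u ≠ pairWt v →
      2 * t + 1 ≤ pairDist (Fin.append u (p u)) (Fin.append v (p v))) :
    24 * t * M ^ 2 + 4 * M ≤ 4 * M ^ 3 + 9 * (r + 1) * M ^ 2 + 24 * t * M := by
  set x : ℕ → Fin (k + r) → ZMod 2 := fun i => Fin.append (stepVec k i) (p (stepVec k i)) with hx
  set T := Finset.univ.filter (fun c : Fin (k + r) => ¬ ((c : ℕ) + 1 < k)) with hT
  have hTc : T.card ≤ r + 1 := by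
    have : T.card ≤ (Finset.Ico (k - 1) (k + r)).card := by
      refine Finset.card_le_card_of_injOn (fun c => (c : ℕ)) ?_ ?_
      · intro c hc
        have := c.isLt
        simp [hT] at hc ⊢
        omega
      · intro a _ b _ hab
        exact Fin.ext hab
    rw [Nat.card_Ico] at this
    omega
  have hpair : ∀ i j : Fin M, 2 * t ≤ (((i : ℕ) - j) + ((j : ℕ) - i)) +
      (∑ c ∈ T, (if pairAt (x i) c ≠ pairAt (x j) c then 1 else 0)) +
      (if i = j then 2 * t else 0) := by
    intro i j
    by_cases hij : i = j
    · simp [hij]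
    · have hne : pairWt (stepVec k i) ≠ pairWt (stepVec k j) := by
        rcases lt_or_gt_of_ne (fun h => hij (Fin.ext h) : (i : ℕ) ≠ j) with h | h
        · exact (stepVec_wt_lt k i j h (by omega)).ne
        · exact (stepVec_wt_lt k j i h (by omega)).ne'
      have h1 := hp _ _ hne
      rw [pairDist_eq, ← Finset.sum_filter_add_sum_filter_not Finset.univ
        (fun c : Fin (k + r) => (c : ℕ) + 1 < k)] at h1
      have h2 := head_bound k r i j (p (stepVec k i)) (p (stepVec k j))
      rw [if_neg hij]
      simp only [hx, hT]
      omega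
  have hsum := Finset.sum_le_sum (fun i (_ : i ∈ (Finset.univ : Finset (Fin M))) =>
    Finset.sum_le_sum (fun j (_ : j ∈ (Finset.univ : Finset (Fin M))) => hpair i j))
  have e1 : ∑ i : Fin M, ∑ j : Fin M, 2 * t = 2 * t * M ^ 2 := by simp; ring
  have e2 : ∑ i : Fin M, ∑ j : Fin M, (if i = j then 2 * t else 0) = 2 * t * M := by
    simp; ring
  have e3 : ∑ i : Fin M, ∑ j : Fin M, (((i : ℕ) - j) + ((j : ℕ) - i)) =
      ∑ i ∈ Finset.range M, ∑ j ∈ Finset.range M, ((i - j) + (j - i)) := by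
    rw [← Fin.sum_univ_eq_sum_range
      (fun i => ∑ j ∈ Finset.range M, ((i - j) + (j - i))) M]
    refine Finset.sum_congr rfl fun i _ => ?_
    rw [← Fin.sum_univ_eq_sum_range (fun j => (((i : ℕ) - j) + (j - (i : ℕ)))) M]
  have e4 : 4 * ∑ i : Fin M, ∑ j : Fin M,
      ∑ c ∈ T, (if pairAt (x i) c ≠ pairAt (x j) c then 1 else 0 : ℕ) ≤ (r + 1) * (3 * M ^ 2) := by
    have : ∑ i : Fin M, ∑ j : Fin M,
      ∑ c ∈ T, (if pairAt (x i) c ≠ pairAt (x j) c then 1 else 0 : ℕ) =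
      ∑ c ∈ T, ∑ i : Fin M, ∑ j : Fin M,
        (if pairAt (x i) c ≠ pairAt (x j) c then 1 else 0 : ℕ) := by
      rw [Finset.sum_comm]
      rw [Finset.sum_congr rfl fun j _ => Finset.sum_comm]
      rw [Finset.sum_comm]
      refine Finset.sum_congr rfl fun c _ => ?_
      rw [Finset.sum_comm]
    rw [this, Finset.mul_sum]
    calc _ ≤ ∑ c ∈ T, 3 * M ^ 2 :=
          Finset.sum_le_sum fun c _ => aux_plotkin M (fun i => pairAt (x i) c)
      _ = T.card * (3 * M ^ 2) := by simp
      _ ≤ _ := Nat.mul_le_mul_right _ hTc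
  have e5 := aux_sum M
  rw [← e3] at e5
  have hs : 2 * t * M ^ 2 ≤ ∑ i : Fin M, ∑ j : Fin M, (((i : ℕ) - j) + ((j : ℕ) - i)) +
     ∑ i : Fin M, ∑ j : Fin M,
      ∑ c ∈ T, (if pairAt (x i) c ≠ pairAt (x j) c then 1 else 0 : ℕ) + 2 * t * M := by
    rw [← e1, ← e2]
    simp only [← Finset.sum_add_distrib]
    exact hsum
  nlinarith

theorem exists_code (k t : ℕ) : ∃ r, ∃ p : (Fin k → ZMod 2) → (Fin r → ZMod 2),
    ∀ u v : Fin k → ZMod 2, pairWt u ≠ pairWt v →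
      2 * t + 1 ≤ pairDist (Fin.append u (p u)) (Fin.append v (p v)) := by
  refine ⟨k * (2 * t + 1), fun u c => u (finProdFinEquiv.symm c).1, ?_⟩
  intro u v huv
  have hne : u ≠ v := fun h => huv (by rw [h])
  obtain ⟨i, hi⟩ := Function.ne_iff.1 hne
  unfold pairDist
  calc 2 * t + 1 = (Finset.univ : Finset (Fin (2 * t + 1))).card := by simp
    _ ≤ _ := Finset.card_le_card_of_injOn
        (fun s => Fin.natAdd k (finProdFinEquiv (i, s))) ?_ ?_
  · intro s _
    simp only [Finset.coe_filter, Finset.mem_univ, true_and, Set.mem_setOf_eq, ne_eq,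
      Prod.mk.injEq, Fin.append_right, Equiv.symm_apply_apply, hi, false_and, not_false_eq_true]
  · intro a _ b _ hab
    have := finProdFinEquiv.injective (Fin.natAdd_injective _ _ hab)
    exact (Prod.mk.inj this).2

theorem stmt_18 (k t : ℕ) (ht : 6 ≤ t) (hk : t < k) :
    8 * (t : ℝ) / 3 - (8 / 9) * Real.sqrt (6 * (t : ℝ) - 4) - 4 / 3
      ≤ (optPairRedundancy k t : ℝ) := by
  obtain ⟨p, hp⟩ : optPairRedundancy k t ∈ {r : ℕ | ∃ p : (Fin k → ZMod 2) → (Fin r → ZMod 2),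
    ∀ u v : Fin k → ZMod 2, pairWt u ≠ pairWt v →
      2 * t + 1 ≤ pairDist (Fin.append u (p u)) (Fin.append v (p v))} :=
    Nat.sInf_mem (exists_code k t)
  generalize optPairRedundancy k t = r at p hp
  have htR : (6 : ℝ) ≤ t := by exact_mod_cast ht
  set s := Real.sqrt (6 * (t : ℝ) - 4) with hs
  have hs2 : s ^ 2 = 6 * t - 4 := Real.sq_sqrt (by linarith)
  have hs0 : 0 ≤ s := Real.sqrt_nonneg _
  have hst : s ≤ t := by
    apply Real.sqrt_le_iff.2
    constructor <;> nlinarith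
  have hs5 : 5 < s := by nlinarith
  have hMt : ⌈s⌉₊ ≤ t := Nat.ceil_le.2 hst
  have hM6 : 6 ≤ ⌈s⌉₊ := Nat.lt_ceil.2 (by exact_mod_cast hs5)
  have hsM : s ≤ ⌈s⌉₊ := Nat.le_ceil s
  have hMs : (⌈s⌉₊ : ℝ) < s + 1 := Nat.ceil_lt_add_one hs0
  have hmain := main_nat k t r ⌈s⌉₊ (by omega) (by omega) p hp
  generalize ⌈s⌉₊ = M at *
  have hR : 24 * (t : ℝ) * M ^ 2 + 4 * M ≤ 4 * M ^ 3 + 9 * (r + 1) * M ^ 2 + 24 * t * M := by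
    exact_mod_cast hmain
  have hM6' : (6 : ℝ) ≤ M := by exact_mod_cast hM6
  have htt : (t : ℝ) = (s ^ 2 + 4) / 6 := by linarith
  rw [htt] at hR ⊢
  have hd : (M - s) ^ 2 ≤ 1 := by nlinarith
  have hR2 : 4 * (s ^ 2 + 4) * (M : ℝ) + 4 ≤ 4 * M ^ 2 + 9 * (r + 1) * M + 4 * (s ^ 2 + 4) := by
    have hpos : (0 : ℝ) < M := by linarith
    refine le_of_mul_le_mul_right ?_ hpos
    nlinarith
  have hfin : (4 * (s ^ 2 + 1 - 2 * s)) * (M : ℝ) ≤ 9 * r * M := by nlinarith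
  have := le_of_mul_le_mul_right hfin (by linarith)
  linarith
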